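/- arXiv:2205.05280 — 2 statements merged into one kernel-verified Lean document; each statement's English description precedes it below -/
import Mathlib

section
/- For every α ∈ (q,1) and every n ∈ ℤ, the mass of the Ismail–Masson measure μ_α at x_n(α) equals the Askey weight times the local mesh: m_n(α) = (−log q) · w_A(x_n(α)) · (q^{−n}/α + α q^n)/2. Equivalently, (−log q) · w_A(x_n(α)) = 2 α^{4n+1} q^{2n²} / (q, −q/α², −α²;q)_∞. -/
noncomputable section

open scoped BigOperators
open Finset MeasureTheory Filter Topology

/-- The finite q-shifted factorial `(a;q)_n`. -/
def qp (q a : ℝ) (n : ℕ) : ℝ := ∏ j ∈ Finset.range n, (1 - a * q ^ j)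

/-- The infinite q-shifted factorial `(a;q)_∞`. -/
def qpi (q a : ℝ) : ℝ := ∏' j : ℕ, (1 - a * q ^ j)

/-- `z(x) = x + √(x²+1)`, so that `2x = z - 1/z`. -/
def zx (x : ℝ) : ℝ := x + Real.sqrt (x ^ 2 + 1)

/-- The Askey–Wilson type polynomial `p_n(x, t)`. -/
def pAW (q t1 t2 t3 t4 : ℝ) (n : ℕ) (x : ℝ) : ℝ :=
  (t1 / q) ^ n * qp q (-q ^ 2 / (t1 * t2)) n * qp q (-q ^ 2 / (t1 * t3)) n *
    qp q (-q ^ 2 / (t1 * t4)) n *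
  ∑ k ∈ Finset.range (n + 1),
    qp q (q ^ (-(n : ℤ))) k * qp q (q ^ (n + 3) / (t1 * t2 * t3 * t4)) k *
      qp q (-q / (t1 * zx x)) k * qp q (q * zx x / t1) k * q ^ k /
    (qp q q k * qp q (-q ^ 2 / (t1 * t2)) k * qp q (-q ^ 2 / (t1 * t3)) k *
      qp q (-q ^ 2 / (t1 * t4)) k)

/-- The normalized weight function `w(x, t)`. -/
def wAW (q t1 t2 t3 t4 : ℝ) (x : ℝ) : ℝ :=
  2 * zx x * qpi q (t1 * t2 * t3 * t4 / q ^ 3) *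
    (qpi q (-t1 * zx x) * qpi q (t1 / zx x) * qpi q (-t2 * zx x) * qpi q (t2 / zx x) *
      qpi q (-t3 * zx x) * qpi q (t3 / zx x) * qpi q (-t4 * zx x) * qpi q (t4 / zx x)) /
  (qpi q q * qpi q (-(zx x) ^ 2) * qpi q (-q / (zx x) ^ 2) * Real.log (1 / q) *
    (qpi q (-t1 * t2 / q) * qpi q (-t1 * t3 / q) * qpi q (-t1 * t4 / q) *
      qpi q (-t2 * t3 / q) * qpi q (-t2 * t4 / q) * qpi q (-t3 * t4 / q)))

/-- The mass points `x_n(α) = (q^{-n}/α - α q^n)/2` of the Ismail–Masson measure. -/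
def xpt (q α : ℝ) (n : ℤ) : ℝ := (q ^ (-n) / α - α * q ^ n) / 2

/-- The masses `m_n(α)` of the Ismail–Masson measure `μ_α`. -/
def mass (q α : ℝ) (n : ℤ) : ℝ :=
  α ^ (4 * n) * q ^ (n * (2 * n - 1)) * (1 + α ^ 2 * q ^ (2 * n)) /
    (qpi q (-α ^ 2) * qpi q (-q / α ^ 2) * qpi q q)

/-- The Askey weight function `w_A(x)`. -/
def wA (q : ℝ) (x : ℝ) : ℝ :=
  -2 * zx x /
    (Real.log q * (qpi q q * qpi q (-(zx x) ^ 2) * qpi q (-q / (zx x) ^ 2)))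

/-- The first factor of `(a;q)_∞` splits off. -/
theorem qpi_eq_mul_qpi {q : ℝ} (hq0 : 0 < q) (hq1 : q < 1) (a : ℝ) :
    qpi q a = (1 - a) * qpi q (a * q) := by
  have hs : Summable fun j : ℕ ↦ -(a * q ^ (j + 1)) := by
    simpa only [pow_succ', neg_mul, mul_assoc] using
      (summable_geometric_of_lt_one hq0.le hq1).mul_left (-(a * q))
  have hm : Multipliable fun j : ℕ ↦ 1 - a * q ^ (j + 1) := by
    simpa only [sub_eq_add_neg] using Real.multipliable_one_add_of_summable hs
  have htail : ∏' j : ℕ, (1 - a * q ^ (j + 1)) = qpi q (a * q) :=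
    tprod_congr fun j ↦ by rw [pow_succ', mul_assoc]
  have hsplit := tprod_eq_zero_mul' (f := fun j : ℕ ↦ 1 - a * q ^ j) hm
  rw [pow_zero, mul_one, htail] at hsplit
  exact hsplit

/-- The modified theta function `(-y, -q/y; q)_∞`. -/
def qtheta (q y : ℝ) : ℝ := qpi q (-y) * qpi q (-q / y)

theorem qtheta_mul_base {q : ℝ} (hq0 : 0 < q) (hq1 : q < 1) {y : ℝ} (hy : 0 < y) :
    qtheta q y = y * qtheta q (y * q) := by
  have h1 : qpi q (-y) = (1 + y) * qpi q (-(y * q)) := by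
    rw [qpi_eq_mul_qpi hq0 hq1 (-y), sub_neg_eq_add, neg_mul]
  have h2 : qpi q (-q / (y * q)) = (1 + 1 / y) * qpi q (-q / y) := by
    rw [qpi_eq_mul_qpi hq0 hq1 (-q / (y * q))]
    congr 1
    · field_simp
      ring
    · congr 1
      field_simp
  unfold qtheta
  rw [h1, h2]
  field_simp
  ring

theorem qtheta_mul_base_sq {q : ℝ} (hq0 : 0 < q) (hq1 : q < 1) {y : ℝ} (hy : 0 < y) :
    qtheta q y = y ^ 2 * q * qtheta q (y * q ^ 2) := by
  rw [qtheta_mul_base hq0 hq1 hy, qtheta_mul_base hq0 hq1 (mul_pos hy hq0),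
    show y * q * q = y * q ^ 2 by ring]
  ring

/-- Quasi-periodicity of `qtheta` under even powers of the base. -/
theorem qtheta_mul_zpow {q : ℝ} (hq0 : 0 < q) (hq1 : q < 1) {y : ℝ} (hy : 0 < y) (n : ℤ) :
    qtheta q y = y ^ (2 * n) * q ^ (n * (2 * n - 1)) * qtheta q (y * q ^ (2 * n)) := by
  have step (k : ℤ) :
      y ^ (2 * k) * q ^ (k * (2 * k - 1)) * qtheta q (y * q ^ (2 * k)) =
        y ^ (2 * (k + 1)) * q ^ ((k + 1) * (2 * (k + 1) - 1)) *
          qtheta q (y * q ^ (2 * (k + 1))) := by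
    have hyk : 0 < y * q ^ (2 * k) := mul_pos hy (zpow_pos hq0 _)
    have e1 : y ^ (2 * (k + 1)) = y ^ (2 * k) * y ^ 2 := by
      rw [mul_add, zpow_add₀ hy.ne']; rfl
    have e2 : q ^ (2 * (k + 1)) = q ^ (2 * k) * q ^ 2 := by
      rw [mul_add, zpow_add₀ hq0.ne']; rfl
    have e3 : q ^ ((k + 1) * (2 * (k + 1) - 1)) =
        q ^ (k * (2 * k - 1)) * (q ^ (2 * k)) ^ 2 * q := by
      rw [pow_two, ← zpow_add₀ hq0.ne', ← zpow_add₀ hq0.ne', ← zpow_add_one₀ hq0.ne']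
      congr 1
      ring
    rw [qtheta_mul_base_sq hq0 hq1 hyk, e1, e2, e3, mul_assoc y]
    ring
  induction n using Int.induction_on with
  | zero => simp
  | succ k ih => rw [ih, step]
  | pred k ih => rw [ih, step (-k - 1), sub_add_cancel]

/-- Reflection `y ↦ 1/y` of `qtheta`. -/
theorem qtheta_inv {q : ℝ} (hq0 : 0 < q) (hq1 : q < 1) {y : ℝ} (hy : 0 < y) :
    qtheta q y = y * qtheta q y⁻¹ := by
  rw [qtheta_mul_base hq0 hq1 hy]
  unfold qtheta
  rw [show -q / (y * q) = -y⁻¹ by field_simp, show -q / y⁻¹ = -(y * q) by field_simp,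
    mul_comm (qpi q (-(y * q)))]

theorem zx_half_sub_inv {z : ℝ} (hz : 0 < z) : zx ((z - z⁻¹) / 2) = z := by
  unfold zx
  rw [show ((z - z⁻¹) / 2) ^ 2 + 1 = ((z + z⁻¹) / 2) ^ 2 by field_simp; ring,
    Real.sqrt_sq (by positivity)]
  ring

theorem zx_xpt {q α : ℝ} (hq0 : 0 < q) (hα : 0 < α) (n : ℤ) :
    zx (xpt q α n) = (α * q ^ n)⁻¹ := by
  rw [← zx_half_sub_inv (z := (α * q ^ n)⁻¹) (by positivity), inv_inv, xpt, zpow_neg, mul_inv,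
    div_eq_mul_inv _ α, mul_comm α⁻¹]

/-- The Askey weight at the mass points, scaled by `-log q`. -/
theorem neg_log_mul_wA_xpt {q α : ℝ} (hq0 : 0 < q) (hq1 : q < 1) (hα : 0 < α) (n : ℤ) :
    (-Real.log q) * wA q (xpt q α n) =
      2 * α ^ (4 * n + 1) * q ^ (2 * n ^ 2) /
        (qpi q q * qpi q (-q / α ^ 2) * qpi q (-α ^ 2)) := by
  have hlog : Real.log q ≠ 0 := (Real.log_neg hq0 hq1).ne
  have hα2 : 0 < α ^ 2 := by positivity
  have hw : α ^ 2 * q ^ (2 * n) = (α * q ^ n) ^ 2 := by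
    rw [mul_pow, mul_comm 2 n, zpow_mul]; rfl
  have hθ : qpi q (-q / α ^ 2) * qpi q (-α ^ 2) =
      α ^ (4 * n + 1) * q ^ (2 * n ^ 2) * (α * q ^ n) *
        qtheta q ((zx (xpt q α n)) ^ 2) := by
    have e1 : α ^ (4 * n + 1) = (α ^ 2) ^ (2 * n) * α := by
      rw [zpow_add_one₀ hα.ne', ← zpow_natCast α 2, ← zpow_mul]
      congr 2
      push_cast
      ring
    have e2 : q ^ (2 * n ^ 2) = q ^ (n * (2 * n - 1)) * q ^ n := by
      rw [← zpow_add₀ hq0.ne']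
      congr 1
      ring
    have h := qtheta_mul_zpow hq0 hq1 hα2 n
    rw [hw, qtheta_inv hq0 hq1 (by positivity : 0 < (α * q ^ n) ^ 2)] at h
    rw [mul_comm, zx_xpt hq0 hα, inv_pow, e1, e2]
    refine Eq.trans h ?_
    ring
  rw [mul_assoc (qpi q q), hθ, wA, mul_assoc (qpi q q)]
  change _ * (_ / (_ * (_ * qtheta q ((zx (xpt q α n)) ^ 2)))) = _
  generalize qtheta q ((zx (xpt q α n)) ^ 2) = θ
  have hA : α ^ (4 * n + 1) ≠ 0 := (zpow_pos hα _).ne'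
  have hQ : q ^ (2 * n ^ 2) ≠ 0 := (zpow_pos hq0 _).ne'
  have hqn : q ^ n ≠ 0 := (zpow_pos hq0 _).ne'
  generalize α ^ (4 * n + 1) = A at *
  generalize q ^ (2 * n ^ 2) = Q at *
  rw [zx_xpt hq0 hα]
  generalize q ^ n = r at *
  generalize qpi q q = P
  field_simp

theorem mass_eq_askey_weight_times_mesh
    (q : ℝ) (hq0 : 0 < q) (hq1 : q < 1)
    (α : ℝ) (hα1 : q < α) (hα2 : α < 1) (n : ℤ) :
    mass q α n =
      (-Real.log q) * wA q (xpt q α n) * ((q ^ (-n) / α + α * q ^ n) / 2) ∧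
    (-Real.log q) * wA q (xpt q α n) =
      2 * α ^ (4 * n + 1) * q ^ (2 * n ^ 2) /
        (qpi q q * qpi q (-q / α ^ 2) * qpi q (-α ^ 2)) := by
  have hα : 0 < α := hq0.trans hα1
  have hw := neg_log_mul_wA_xpt hq0 hq1 hα n
  refine ⟨?_, hw⟩
  have e1 : α ^ (4 * n + 1) = α ^ (4 * n) * α := zpow_add_one₀ hα.ne' _
  have e2 : q ^ (2 * n ^ 2) = q ^ (n * (2 * n - 1)) * q ^ n := by
    rw [← zpow_add₀ hq0.ne']
    congr 1
    ring
  have e3 : q ^ (2 * n) = (q ^ n) ^ 2 := by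
    rw [mul_comm 2 n, zpow_mul]; rfl
  have hqn : q ^ n ≠ 0 := (zpow_pos hq0 _).ne'
  have hm : α ^ (4 * n) * q ^ (n * (2 * n - 1)) * (1 + α ^ 2 * q ^ (2 * n)) =
      2 * α ^ (4 * n + 1) * q ^ (2 * n ^ 2) * ((q ^ (-n) / α + α * q ^ n) / 2) := by
    rw [e1, e2, e3, zpow_neg]
    generalize α ^ (4 * n) = A
    generalize q ^ (n * (2 * n - 1)) = Q
    generalize q ^ n = r at *
    field_simp
  rw [hw, mass, hm]
  ring
end
end

section
/- Let t₁,t₂,t₃,t₄ be nonzero real numbers (with all q-shifted factorials appearing below nonzero). For every integer n ≥ 1 and all x ∈ ℝ, the Askey–Wilson operator lowers the degree of p_n: (D_q p_n(·,t))(x) = [2(1 − q^n)(1 − q^{n+3}/(t₁t₂t₃t₄)) / ((1 − q) q^{(n−1)/2})] · p_{n−1}(x, q^{−1/2}t), where q^{−1/2}t = (q^{−1/2}t₁, q^{−1/2}t₂, q^{−1/2}t₃, q^{−1/2}t₄). -/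
noncomputable section

open scoped BigOperators
open Finset MeasureTheory Filter Topology

/-- The Askey–Wilson divided difference operator `D_q`. -/
def Dq (q : ℝ) (f : ℝ → ℝ) (x : ℝ) : ℝ :=
  (f ((Real.sqrt q * zx x - 1 / (Real.sqrt q * zx x)) / 2) -
    f ((zx x / Real.sqrt q - Real.sqrt q / zx x) / 2)) /
  ((Real.sqrt q - 1 / Real.sqrt q) * (zx x + 1 / zx x) / 2)

/-- The averaging operator `A_q`. -/
def Aqop (q : ℝ) (f : ℝ → ℝ) (x : ℝ) : ℝ :=
  (f ((Real.sqrt q * zx x - 1 / (Real.sqrt q * zx x)) / 2) +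
    f ((zx x / Real.sqrt q - Real.sqrt q / zx x) / 2)) / 2

theorem qp_succ (q a : ℝ) (n : ℕ) : qp q a (n + 1) = qp q a n * (1 - a * q ^ n) := by
  simp [qp, Finset.prod_range_succ]

theorem qp_succ_left (q a : ℝ) (n : ℕ) : qp q a (n + 1) = (1 - a) * qp q (a * q) n := by
  unfold qp
  rw [Finset.prod_range_succ', mul_comm]
  simp [pow_succ', mul_assoc]

theorem zx_pos (x : ℝ) : 0 < zx x := by
  have h : |x| < √(x ^ 2 + 1) := by
    rw [← Real.sqrt_sq_eq_abs]
    exact Real.sqrt_lt_sqrt (sq_nonneg x) (by linarith)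
  unfold zx
  linarith [neg_abs_le x]

theorem zx_half_sub_inv_s3 {w : ℝ} (hw : 0 < w) : zx ((w - 1 / w) / 2) = w := by
  have h : ((w - 1 / w) / 2) ^ 2 + 1 = ((w + 1 / w) / 2) ^ 2 := by
    field_simp
    ring
  rw [zx, h, Real.sqrt_sq (by positivity)]
  ring

/-- The difference of the Askey–Wilson basis functions at `s z` and `z / s`, where `s ^ 2 = q`. -/
theorem basis_sub {s t z : ℝ} (hs : s ≠ 0) (ht : t ≠ 0) (hz : z ≠ 0) (k : ℕ) :
    qp (s ^ 2) (-s ^ 2 / (t * (s * z))) (k + 1) * qp (s ^ 2) (s ^ 2 * (s * z) / t) (k + 1) -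
      qp (s ^ 2) (-s ^ 2 / (t * (z / s))) (k + 1) * qp (s ^ 2) (s ^ 2 * (z / s) / t) (k + 1) =
    s / t * (1 - (s ^ 2) ^ (k + 1)) * (z + 1 / z) *
      (qp (s ^ 2) (-s ^ 2 / (t / s * z)) k * qp (s ^ 2) (s ^ 2 * z / (t / s)) k) := by
  rw [qp_succ_left _ (-s ^ 2 / (t * (s * z))), qp_succ _ (s ^ 2 * (s * z) / t),
    qp_succ _ (-s ^ 2 / (t * (z / s))), qp_succ_left _ (s ^ 2 * (z / s) / t)]
  have e1 : -s ^ 2 / (t * (s * z)) * s ^ 2 = -s ^ 2 / (t / s * z) := by field_simp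
  have e2 : s ^ 2 * (s * z) / t = s ^ 2 * z / (t / s) := by field_simp
  have e3 : -s ^ 2 / (t * (z / s)) = -s ^ 2 / (t / s * z) := by field_simp
  have e4 : s ^ 2 * (z / s) / t * s ^ 2 = s ^ 2 * z / (t / s) := by field_simp
  rw [e1, e2, e3, e4]
  generalize qp (s ^ 2) (-s ^ 2 / (t / s * z)) k = X
  generalize qp (s ^ 2) (s ^ 2 * z / (t / s)) k = Y
  field_simp
  ring

/-- The lowering relation for the difference of `pAW` at `s z` and `z / s`, where `s ^ 2 = q`. -/
theorem pAW_sub {s t1 t2 t3 t4 : ℝ} (hs0 : 0 < s) (hs1 : s < 1)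
    (ht1 : t1 ≠ 0) (ht2 : t2 ≠ 0) (ht3 : t3 ≠ 0) (ht4 : t4 ≠ 0)
    (h2 : ∀ k, qp (s ^ 2) (-(s ^ 2) ^ 2 / (t1 * t2)) k ≠ 0)
    (h3 : ∀ k, qp (s ^ 2) (-(s ^ 2) ^ 2 / (t1 * t3)) k ≠ 0)
    (h4 : ∀ k, qp (s ^ 2) (-(s ^ 2) ^ 2 / (t1 * t4)) k ≠ 0)
    (m : ℕ) {x y₁ y₂ : ℝ} (hy₁ : zx y₁ = s * zx x) (hy₂ : zx y₂ = zx x / s) :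
    pAW (s ^ 2) t1 t2 t3 t4 (m + 1) y₁ - pAW (s ^ 2) t1 t2 t3 t4 (m + 1) y₂ =
      (1 - (s ^ 2) ^ (-((m + 1 : ℕ) : ℤ))) *
        (1 - (s ^ 2) ^ (m + 1 + 3) / (t1 * t2 * t3 * t4)) * s * s ^ m * (zx x + 1 / zx x) *
        pAW (s ^ 2) (t1 / s) (t2 / s) (t3 / s) (t4 / s) m x := by
  have hz := (zx_pos x).ne'
  have hs := hs0.ne'
  have hq0 : 0 < s ^ 2 := by positivity
  have hq1 : s ^ 2 < 1 := pow_lt_one₀ hs0.le hs1 two_ne_zero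
  have arg : ∀ {t : ℝ}, t ≠ 0 →
      -(s ^ 2) ^ 2 / (t1 * t) * s ^ 2 = -(s ^ 2) ^ 2 / (t1 / s * (t / s)) := by
    intro t ht
    field_simp
  have step : ∀ {t : ℝ}, t ≠ 0 → ∀ k, qp (s ^ 2) (-(s ^ 2) ^ 2 / (t1 * t)) (k + 1) =
      (1 - -(s ^ 2) ^ 2 / (t1 * t)) * qp (s ^ 2) (-(s ^ 2) ^ 2 / (t1 / s * (t / s))) k := by
    intro t ht k
    rw [qp_succ_left, arg ht]
  have stepn : ∀ k, qp (s ^ 2) ((s ^ 2) ^ (-((m + 1 : ℕ) : ℤ))) (k + 1) =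
      (1 - (s ^ 2) ^ (-((m + 1 : ℕ) : ℤ))) * qp (s ^ 2) ((s ^ 2) ^ (-(m : ℤ))) k := by
    intro k
    rw [qp_succ_left]
    congr 2
    rw [← zpow_add_one₀ hq0.ne']
    congr 1
    push_cast
    ring
  have stepT : ∀ k, qp (s ^ 2) ((s ^ 2) ^ (m + 1 + 3) / (t1 * t2 * t3 * t4)) (k + 1) =
      (1 - (s ^ 2) ^ (m + 1 + 3) / (t1 * t2 * t3 * t4)) *
        qp (s ^ 2) ((s ^ 2) ^ (m + 3) / (t1 / s * (t2 / s) * (t3 / s) * (t4 / s))) k := by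
    intro k
    rw [qp_succ_left]
    congr 2
    field_simp
    ring
  have head : ∀ {a : ℝ}, (∀ k, qp (s ^ 2) a k ≠ 0) → 1 - a ≠ 0 := fun h =>
    left_ne_zero_of_mul (qp_succ_left _ _ 0 ▸ h 1)
  have b2 := head h2
  have b3 := head h3
  have b4 := head h4
  have zero : ∀ a, qp (s ^ 2) a 0 = 1 := fun a => by simp [qp]
  unfold pAW
  rw [hy₁, hy₂, ← mul_sub, Finset.sum_range_succ' (M := ℝ) _ (m + 1),
    Finset.sum_range_succ' (M := ℝ) _ (m + 1)]
  simp only [step ht2, step ht3, step ht4, stepn, stepT, zero]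
  rw [add_sub_add_right_eq_sub, ← Finset.sum_sub_distrib, Finset.mul_sum, Finset.mul_sum,
    Finset.mul_sum]
  refine Finset.sum_congr rfl fun k _ => ?_
  have hb := basis_sub hs ht1 hz k
  have e : 1 - (s ^ 2) ^ (k + 1) ≠ 0 := (sub_pos.2 (pow_lt_one₀ hq0.le hq1 k.succ_ne_zero)).ne'
  rw [qp_succ _ (s ^ 2) k, ← pow_succ']
  generalize 1 - -(s ^ 2) ^ 2 / (t1 * t2) = B2 at *
  generalize 1 - -(s ^ 2) ^ 2 / (t1 * t3) = B3 at *
  generalize 1 - -(s ^ 2) ^ 2 / (t1 * t4) = B4 at *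
  generalize 1 - (s ^ 2) ^ (k + 1) = E at *
  generalize 1 - (s ^ 2) ^ (-((m + 1 : ℕ) : ℤ)) = N at *
  generalize 1 - (s ^ 2) ^ (m + 1 + 3) / (t1 * t2 * t3 * t4) = T at *
  have factor : ∀ C a b F₁ F₂ G₁ G₂ Q D : ℝ,
      C * (a * b * F₁ * F₂ * Q / D - a * b * G₁ * G₂ * Q / D) =
        C * a * b * Q / D * (F₁ * F₂ - G₁ * G₂) := by
    intros
    ring
  rw [factor, hb]
  generalize qp (s ^ 2) (-s ^ 2 / (t1 / s * zx x)) k = X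
  generalize qp (s ^ 2) (s ^ 2 * zx x / (t1 / s)) k = Y
  have pow_eq : (t1 / s ^ 2) ^ (m + 1) = t1 / s ^ 2 * s ^ m * (t1 / s / s ^ 2) ^ m := by
    rw [pow_succ', mul_assoc, ← mul_pow]
    congr 2
    field_simp
  rw [pow_eq, pow_succ (s ^ 2) k]
  generalize (t1 / s / s ^ 2) ^ m = P
  generalize qp (s ^ 2) (-(s ^ 2) ^ 2 / (t1 / s * (t2 / s))) k = U2 at *
  generalize qp (s ^ 2) (-(s ^ 2) ^ 2 / (t1 / s * (t3 / s))) k = U3 at *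
  generalize qp (s ^ 2) (-(s ^ 2) ^ 2 / (t1 / s * (t4 / s))) k = U4 at *
  generalize qp (s ^ 2) (s ^ 2) k = U at *
  generalize qp (s ^ 2) _ m = V2
  generalize qp (s ^ 2) _ m = V3
  generalize qp (s ^ 2) _ m = V4
  generalize qp (s ^ 2) _ k = R
  generalize qp (s ^ 2) _ k = S
  generalize (s ^ 2) ^ k = Q
  generalize s ^ m = M
  generalize zx x + 1 / zx x = W
  calc
    _ = (s ^ 2 / s ^ 2) * (t1 / t1) * (E / E) * (B2 / B2) * (B3 / B3) * (B4 / B4) *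
        (N * T * s * M * W * (P * V2 * V3 * V4 * (R * S * X * Y * Q / (U * U2 * U3 * U4)))) := by
      ring
    _ = _ := by
      rw [div_self (pow_ne_zero 2 hs), div_self ht1, div_self e, div_self b2, div_self b3,
        div_self b4]
      simp only [one_mul]

theorem lowering_operator
    (q : ℝ) (hq0 : 0 < q) (hq1 : q < 1) (t1 t2 t3 t4 : ℝ)
    (ht1 : t1 ≠ 0) (ht2 : t2 ≠ 0) (ht3 : t3 ≠ 0) (ht4 : t4 ≠ 0)
    (hne : ∀ k : ℕ,
      qp q (-q ^ 2 / (t1 * t2)) k ≠ 0 ∧ qp q (-q ^ 2 / (t1 * t3)) k ≠ 0 ∧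
      qp q (-q ^ 2 / (t1 * t4)) k ≠ 0 ∧ qp q (-q ^ 2 / (t2 * t3)) k ≠ 0 ∧
      qp q (-q ^ 2 / (t2 * t4)) k ≠ 0 ∧ qp q (-q ^ 2 / (t3 * t4)) k ≠ 0 ∧
      qp q (-q ^ 3 / (t1 * t2)) k ≠ 0 ∧ qp q (-q ^ 3 / (t1 * t3)) k ≠ 0 ∧
      qp q (-q ^ 3 / (t1 * t4)) k ≠ 0 ∧ qp q (-q ^ 3 / (t2 * t3)) k ≠ 0 ∧
      qp q (-q ^ 3 / (t2 * t4)) k ≠ 0 ∧ qp q (-q ^ 3 / (t3 * t4)) k ≠ 0) :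
    ∀ n : ℕ, 1 ≤ n → ∀ x : ℝ,
      Dq q (fun y => pAW q t1 t2 t3 t4 n y) x =
        2 * (1 - q ^ n) * (1 - q ^ (n + 3) / (t1 * t2 * t3 * t4)) /
            ((1 - q) * q ^ (((n : ℝ) - 1) / 2)) *
          pAW q (t1 / Real.sqrt q) (t2 / Real.sqrt q) (t3 / Real.sqrt q)
            (t4 / Real.sqrt q) (n - 1) x := by
  intro n hn x
  obtain ⟨m, rfl⟩ := Nat.exists_eq_add_of_le' hn
  obtain ⟨s, hs0, rfl⟩ : ∃ s : ℝ, 0 < s ∧ q = s ^ 2 :=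
    ⟨√q, Real.sqrt_pos.2 hq0, (Real.sq_sqrt hq0.le).symm⟩
  have hs1 : s < 1 := by
    by_contra! h
    exact absurd hq1 (one_le_pow₀ h).not_gt
  have hs := hs0.ne'
  have hz := zx_pos x
  have hy₁ : zx ((s * zx x - 1 / (s * zx x)) / 2) = s * zx x := zx_half_sub_inv_s3 (by positivity)
  have hy₂ : zx ((zx x / s - s / zx x) / 2) = zx x / s := by
    simpa only [one_div_div] using zx_half_sub_inv_s3 (div_pos hz hs0)
  have hpow : (s ^ 2) ^ (((m + 1 : ℕ) - 1 : ℝ) / 2) = s ^ m := by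
    rw [← Real.rpow_natCast s 2, ← Real.rpow_mul hs0.le, ← Real.rpow_natCast s m]
    congr 1
    push_cast
    ring
  have hsub := pAW_sub hs0 hs1 ht1 ht2 ht3 ht4 (fun k => (hne k).1) (fun k => (hne k).2.1)
    (fun k => (hne k).2.2.1) m hy₁ hy₂
  have hden : 1 - s ^ 2 ≠ 0 := (sub_pos.2 hq1).ne'
  have hden' : s - 1 / s = -(1 - s ^ 2) / s := by
    field_simp
    ring
  have hw : zx x + 1 / zx x ≠ 0 := by positivity
  have hN : 1 - (s ^ 2) ^ (-((m + 1 : ℕ) : ℤ)) = -(1 - (s ^ 2) ^ (m + 1)) / (s ^ m * s) ^ 2 := by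
    rw [zpow_neg, zpow_natCast]
    field_simp
    ring
  rw [Dq, Real.sqrt_sq hs0.le, hsub, hpow, hden', hN, Nat.add_sub_cancel]
  generalize pAW (s ^ 2) (t1 / s) (t2 / s) (t3 / s) (t4 / s) m x = P
  generalize zx x + 1 / zx x = W at *
  generalize 1 - (s ^ 2) ^ (m + 1) = A
  generalize 1 - (s ^ 2) ^ (m + 1 + 3) / (t1 * t2 * t3 * t4) = T
  generalize 1 - s ^ 2 = D at *
  field_simp
end
end
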